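/- arXiv:2604.25150 — 4 statements merged into one kernel-verified Lean document; each statement's English description precedes it below -/
import Mathlib

section
/- Let H ∈ ℝ^{n×n} be symmetric and invertible, let N ≥ n, and let B ∈ ℝ^{n×N} be such that B Bᵀ is invertible. Then the symmetric matrix Bᵀ H B ∈ ℝ^{N×N} has exactly n nonzero eigenvalues counted with multiplicity (and N − n zero eigenvalues), and the product of its nonzero eigenvalues equals det(H) · det(B Bᵀ). -/
open Matrix Polynomial

/-- The factorization of a polynomial as a power of `X` times a polynomial with nonzero constant
coefficient is unique. -/
theorem Polynomial.X_pow_mul_inj_of_coeff_zero_ne_zero {R : Type*} [Semiring R] {p q : R[X]}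
    {a b : ℕ} (hp : p.coeff 0 ≠ 0) (hq : q.coeff 0 ≠ 0) (h : X ^ a * p = X ^ b * q) :
    a = b ∧ p = q := by
  have hab : a = b := by
    refine le_antisymm (not_lt.mp fun hlt => hq ?_) (not_lt.mp fun hlt => hp ?_)
    · simpa [coeff_X_pow_mul', hlt.not_ge] using (congrArg (coeff · b) h).symm
    · simpa [coeff_X_pow_mul', hlt.not_ge] using congrArg (coeff · a) h
  subst hab
  exact ⟨rfl, (isRegular_X_pow _).left.eq_iff.mp h⟩

/-- A product of linear factors splits off a power of `X` for the zero roots. -/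
theorem Polynomial.prod_X_sub_C_eq_X_pow_mul {R ι : Type*} [CommRing R] [DecidableEq R]
    [Fintype ι] (μ : ι → R) :
    ∏ i, (X - C (μ i)) =
      X ^ (Fintype.card ι - (Finset.univ.filter fun i => μ i ≠ 0).card) *
        ∏ i ∈ Finset.univ.filter (fun i => μ i ≠ 0), (X - C (μ i)) := by
  have hcard := Finset.card_filter_add_card_filter_not (s := Finset.univ) (fun i => μ i ≠ 0)
  rw [Finset.card_univ] at hcard
  have hzero : ∏ i ∈ Finset.univ.filter (fun i => ¬ μ i ≠ 0), (X - C (μ i)) =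
      X ^ (Finset.univ.filter fun i => ¬ μ i ≠ 0).card := by
    refine Finset.prod_eq_pow_card fun i hi => ?_
    have hi0 : μ i = 0 := by simpa using hi
    simp [hi0]
  rw [← Finset.prod_filter_mul_prod_filter_not Finset.univ (fun i => μ i ≠ 0), hzero, mul_comm,
    ← hcard, Nat.add_sub_cancel_left]

/-- If `H ∈ ℝ^{n×n}` is symmetric and invertible and `B ∈ ℝ^{n×N}` (with `n ≤ N`) has
`B Bᵀ` invertible, then the symmetric matrix `Bᵀ H B` has exactly `n` nonzero
eigenvalues counted with multiplicity (hence `N − n` zero eigenvalues), and the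
product of its nonzero eigenvalues (its pseudo-determinant) equals
`det H · det(B Bᵀ)`.  The eigenvalues with multiplicity are encoded by a list
`mu : Fin N → ℝ` factoring the characteristic polynomial. -/
theorem pdet_of_congruence
    (n N : ℕ) (hn : n ≤ N)
    (H : Matrix (Fin n) (Fin n) ℝ) (hHsym : Hᵀ = H) (hH : IsUnit H.det)
    (B : Matrix (Fin n) (Fin N) ℝ) (hB : IsUnit (B * Bᵀ).det)
    (mu : Fin N → ℝ)
    (hmuchar : (Bᵀ * H * B).charpoly = ∏ i, (X - C (mu i))) :
    (Finset.univ.filter fun i => mu i ≠ 0).card = n ∧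
    ∏ i ∈ Finset.univ.filter (fun i => mu i ≠ 0), mu i = H.det * (B * Bᵀ).det := by
  have hdet : (H * B * Bᵀ).det = H.det * (B * Bᵀ).det := by rw [Matrix.mul_assoc, det_mul]
  have hdet0 : (H * B * Bᵀ).det ≠ 0 := hdet ▸ mul_ne_zero hH.ne_zero hB.ne_zero
  have hsign := det_eq_sign_charpoly_coeff (H * B * Bᵀ)
  have hcoeff : (∏ i ∈ Finset.univ.filter (fun i => mu i ≠ 0), (X - C (mu i))).coeff 0 =
      (-1) ^ (Finset.univ.filter fun i => mu i ≠ 0).card *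
        ∏ i ∈ Finset.univ.filter (fun i => mu i ≠ 0), mu i := by
    simp [coeff_zero_eq_eval_zero, eval_prod, Finset.prod_neg]
  have hfactor := charpoly_mul_comm_of_le Bᵀ (H * B) (by simpa using hn)
  rw [← Matrix.mul_assoc, hmuchar, prod_X_sub_C_eq_X_pow_mul] at hfactor
  obtain ⟨hpow, hpoly⟩ := X_pow_mul_inj_of_coeff_zero_ne_zero
    (hcoeff ▸ mul_ne_zero (pow_ne_zero _ (by norm_num))
      (Finset.prod_ne_zero_iff.mpr fun i hi => (Finset.mem_filter.mp hi).2))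
    (fun h => hdet0 (by rw [hsign, h, mul_zero])) hfactor
  have hle := Finset.card_le_univ (Finset.univ.filter fun i => mu i ≠ 0)
  simp only [Fintype.card_fin] at hpow hle
  have hcard : (Finset.univ.filter fun i => mu i ≠ 0).card = n := by omega
  refine ⟨hcard, ?_⟩
  rw [← hdet, hsign, ← hpoly, hcoeff, hcard, Fintype.card_fin, ← mul_assoc, ← mul_pow]
  simp
end

section
/- (Pseudo-determinant under splitting.) Fix n ≥ 2, distinct indices s, d ∈ {1,…,n}, an integer m ≥ 1, and coefficients α₁,…,α_m ∈ ℝ with α₁ + ⋯ + α_m = 1. Let N = n + 2(m−1) and let B ∈ ℝ^{n×N} be the splitting matrix whose columns are: e_o for each o ∉ {s,d}, m copies of e_s, and α₁ e_d, …, α_m e_d. Let H ∈ ℝ^{n×n} be symmetric positive definite and set H' = Bᵀ H B. Then the product of the nonzero eigenvalues of H' (counted with multiplicity) equals m · (α₁² + ⋯ + α_m²) · det(H), and this quantity is ≥ det(H), with equality if and only if α_i = 1/m for every i. -/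
open Matrix Polynomial

/-- Column index type for the splitting matrix: the untouched indices
`{o : Fin n // o ≠ s ∧ o ≠ d}`, then `m` copies of `e_s`, then `m` columns `α k • e_d`. -/
abbrev SplitIndex (n : ℕ) (s d : Fin n) (m : ℕ) : Type :=
  {o : Fin n // o ≠ s ∧ o ≠ d} ⊕ (Fin m ⊕ Fin m)

/-- The splitting matrix `B ∈ ℝ^{n×(n+2(m−1))}` whose columns are: `e_o` for each
`o ∉ {s, d}`, `m` copies of `e_s`, and the `m` vectors `α 1 • e_d, …, α m • e_d`. -/
def splittingMatrix (n : ℕ) (s d : Fin n) (m : ℕ) (α : Fin m → ℝ) :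
    Matrix (Fin n) (SplitIndex n s d m) ℝ :=
  fun i c =>
    match c with
    | Sum.inl o => if i = o.val then 1 else 0
    | Sum.inr (Sum.inl _) => if i = s then 1 else 0
    | Sum.inr (Sum.inr k) => if i = d then α k else 0

theorem eq_of_X_pow_mul_eq_X_pow_mul {R : Type*} [CommRing R] {p q : R[X]} {a b : ℕ}
    (hp : p.coeff 0 ≠ 0) (hq : q.coeff 0 ≠ 0) (h : X ^ a * p = X ^ b * q) : p = q := by
  have hab : a = b := by
    rcases lt_trichotomy a b with hlt | heq | hgt
    · have := congrArg (fun r => r.coeff a) h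
      simp [coeff_X_pow_mul', hlt.not_ge, hp] at this
    · exact heq
    · have := congrArg (fun r => r.coeff b) h
      simp [coeff_X_pow_mul', hgt.not_ge, hq.symm] at this
  subst hab
  exact (isRegular_X_pow a).left h

/-- If `A * B` is invertible, the product of the nonzero roots of the characteristic polynomial
of `B * A` is `det (A * B)`. -/
theorem prod_nonzero_roots_charpoly_mul_comm {K ι κ : Type*} [Field K] [DecidableEq K]
    [Fintype ι] [DecidableEq ι] [Fintype κ] [DecidableEq κ]
    (A : Matrix ι κ K) (B : Matrix κ ι K) (hdet : (A * B).det ≠ 0) (mu : κ → K)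
    (hmu : (B * A).charpoly = ∏ i, (X - C (mu i))) :
    ∏ i with mu i ≠ 0, mu i = (A * B).det := by
  set P : K[X] := ∏ i with mu i ≠ 0, (X - C (mu i)) with hP
  have hsplit : ∏ i, (X - C (mu i)) =
      X ^ (Finset.univ.filter fun i => ¬ mu i ≠ 0).card * P := by
    rw [← Finset.prod_filter_mul_prod_filter_not Finset.univ (fun i => mu i ≠ 0), mul_comm,
      ← Finset.prod_const]
    congr 1
    refine Finset.prod_congr rfl fun i hi => ?_
    simp_all
  have hP0 : P.coeff 0 = ∏ i with mu i ≠ 0, -mu i := by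
    simp [hP, coeff_zero_eq_eval_zero, eval_prod]
  have hQ0 : (A * B).charpoly.coeff 0 = (-1) ^ Fintype.card ι * (A * B).det := by
    rw [det_eq_sign_charpoly_coeff, ← mul_assoc, ← mul_pow]
    simp
  have hPQ : P = (A * B).charpoly := by
    refine eq_of_X_pow_mul_eq_X_pow_mul
      (a := Fintype.card ι + (Finset.univ.filter fun i => ¬ mu i ≠ 0).card)
      (b := Fintype.card κ) ?_ ?_ ?_
    · rw [hP0, Finset.prod_ne_zero_iff]
      simp
    · rw [hQ0]
      simpa using hdet
    · rw [pow_add, mul_assoc, ← hsplit, ← hmu, charpoly_mul_comm']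
  have hcard : (Finset.univ.filter fun i => mu i ≠ 0).card = Fintype.card ι := by
    rw [← charpoly_natDegree_eq_dim (A * B), ← hPQ, hP, natDegree_finsetProd_X_sub_C_eq_card]
  have h := congrArg (fun r => r.coeff 0) hPQ
  simp only [hP0, hQ0, Finset.prod_neg, hcard] at h
  exact mul_left_cancel₀ (pow_ne_zero _ (neg_ne_zero.mpr one_ne_zero)) h

theorem splittingMatrix_mul_transpose (n : ℕ) (s d : Fin n) (hsd : s ≠ d) (m : ℕ)
    (α : Fin m → ℝ) :
    splittingMatrix n s d m α * (splittingMatrix n s d m α)ᵀ =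
      diagonal fun i => if i = s then (m : ℝ) else if i = d then ∑ k, α k ^ 2 else 1 := by
  ext i j
  have hsub : ∑ o : {o : Fin n // o ≠ s ∧ o ≠ d},
      ((if i = o.val then (1 : ℝ) else 0) * if j = o.val then 1 else 0) =
      if i = j ∧ i ≠ s ∧ i ≠ d then 1 else 0 := by
    rw [← Finset.sum_subtype (Finset.univ.filter fun o => o ≠ s ∧ o ≠ d) (by simp)
      (fun o => (if i = o then (1 : ℝ) else 0) * if j = o then 1 else 0), Finset.sum_filter]
    rw [Finset.sum_eq_single i (by grind) (by simp)]
    grind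
  simp only [mul_apply, transpose_apply, Fintype.sum_sum_type, splittingMatrix, hsub,
    diagonal_apply, Finset.sum_const, Finset.card_univ, Fintype.card_fin, nsmul_eq_mul]
  have hd : ∑ k, ((if i = d then α k else 0) * if j = d then α k else 0) =
      if i = d ∧ j = d then ∑ k, α k ^ 2 else 0 := by
    by_cases hi : i = d <;> by_cases hj : j = d <;> simp [hi, hj, sq]
  rw [hd]
  grind

theorem det_splittingMatrix_mul_transpose (n : ℕ) (s d : Fin n) (hsd : s ≠ d) (m : ℕ)
    (α : Fin m → ℝ) :
    (splittingMatrix n s d m α * (splittingMatrix n s d m α)ᵀ).det = m * ∑ k, α k ^ 2 := by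
  rw [splittingMatrix_mul_transpose n s d hsd, det_diagonal,
    ← Finset.prod_subset (Finset.subset_univ {s, d}) (by simp; grind), Finset.prod_pair hsd]
  simp [hsd.symm]

theorem card_mul_sum_sq_eq_one_add {m : ℕ} (hm : 1 ≤ m) {α : Fin m → ℝ} (hα : ∑ i, α i = 1) :
    m * ∑ k, α k ^ 2 = 1 + m * ∑ k, (α k - 1 / m) ^ 2 := by
  have hm0 : (m : ℝ) ≠ 0 := by positivity
  simp only [sub_sq, Finset.sum_add_distrib, Finset.sum_sub_distrib, ← Finset.sum_mul,
    ← Finset.mul_sum, hα, Finset.sum_const, Finset.card_univ, Fintype.card_fin, nsmul_eq_mul]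
  field_simp
  ring

/-- Pseudo-determinant under splitting: for `H` symmetric positive definite and
`H' = Bᵀ H B` with `B` the splitting matrix of an `m`-way split with coefficients `α`
summing to 1, the product of the nonzero eigenvalues of `H'` (counted with
multiplicity, encoded by an eigenvalue list `mu` factoring the characteristic
polynomial) equals `m (Σ α k²) det H`; this is `≥ det H`, with equality iff
`α i = 1/m` for all `i`. -/
theorem pdet_under_splitting
    (n : ℕ) (hn : 2 ≤ n) (s d : Fin n) (hsd : s ≠ d)
    (m : ℕ) (hm : 1 ≤ m) (α : Fin m → ℝ) (hα : ∑ i, α i = 1)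
    (H : Matrix (Fin n) (Fin n) ℝ) (hH : H.PosDef)
    (mu : SplitIndex n s d m → ℝ)
    (hmuchar : ((splittingMatrix n s d m α)ᵀ * H * splittingMatrix n s d m α).charpoly
        = ∏ i, (X - C (mu i))) :
    ∏ i ∈ Finset.univ.filter (fun i => mu i ≠ 0), mu i
        = (m : ℝ) * (∑ k, α k ^ 2) * H.det ∧
    H.det ≤ ∏ i ∈ Finset.univ.filter (fun i => mu i ≠ 0), mu i ∧
    (∏ i ∈ Finset.univ.filter (fun i => mu i ≠ 0), mu i = H.det ↔
      ∀ i, α i = 1 / (m : ℝ)) := by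
  have hm0 : (0 : ℝ) < m := by positivity
  have hdev := card_mul_sum_sq_eq_one_add hm hα
  have hsq : 0 ≤ ∑ k, (α k - 1 / (m : ℝ)) ^ 2 := Finset.sum_nonneg fun k _ => sq_nonneg _
  have hdetH := hH.det_pos
  have hdet : (splittingMatrix n s d m α * ((splittingMatrix n s d m α)ᵀ * H)).det
      = (m : ℝ) * (∑ k, α k ^ 2) * H.det := by
    rw [← Matrix.mul_assoc, det_mul, det_splittingMatrix_mul_transpose n s d hsd]
  have hprod : ∏ i ∈ Finset.univ.filter (fun i => mu i ≠ 0), mu i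
      = (m : ℝ) * (∑ k, α k ^ 2) * H.det := by
    rw [← hdet]
    convert prod_nonzero_roots_charpoly_mul_comm _ _ ?_ mu hmuchar
    rw [hdet, hdev]
    positivity
  refine ⟨hprod, ?_, ?_⟩
  · rw [hprod, hdev]
    exact le_mul_of_one_le_left hdetH.le (le_add_of_nonneg_right (by positivity))
  · rw [hprod, hdev, mul_eq_right₀ hdetH.ne', add_eq_left, mul_eq_zero_iff_left hm0.ne',
      Finset.sum_eq_zero_iff_of_nonneg fun k _ => sq_nonneg _]
    simp [sub_eq_zero]
end

section
/- (Even split preserves the pseudo-determinant.) Fix n ≥ 2, distinct indices s, d ∈ {1,…,n}, and an integer m ≥ 1. Let N = n + 2(m−1) and let B ∈ ℝ^{n×N} be the splitting matrix whose columns are: e_o for each o ∉ {s,d}, m copies of e_s, and m copies of (1/m) e_d. Let H ∈ ℝ^{n×n} be symmetric positive definite and set H' = Bᵀ H B. Then the product of the nonzero eigenvalues of H' (counted with multiplicity) equals det(H); that is, the even (uniform) split leaves the pseudo-determinant, and hence the local ellipsoidal volume modulo the symmetry directions, unchanged. -/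
open Matrix Polynomial

/-- Over a field, if `M` is invertible and `X ^ k * M.charpoly` factors as
`X ^ l * ∏ i, (X - C (mu i))`, then the product of the nonzero `mu i` is `det M`. -/
theorem prod_ne_zero_eq_det_of_X_pow_mul_charpoly {K ι κ : Type*} [Field K] [DecidableEq K]
    [Fintype ι] [Fintype κ] [DecidableEq κ] (M : Matrix κ κ K) (hM : M.det ≠ 0) (mu : ι → K)
    (k l : ℕ) (h : X ^ l * ∏ i, (X - C (mu i)) = X ^ k * M.charpoly) :
    ∏ i ∈ Finset.univ.filter (fun i => mu i ≠ 0), mu i = M.det := by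
  have hne : X ^ k * M.charpoly ≠ 0 :=
    mul_ne_zero (pow_ne_zero _ X_ne_zero) M.charpoly_monic.ne_zero
  have hprod : ∏ i, (X - C (mu i)) ≠ 0 := Finset.prod_ne_zero_iff.mpr fun i _ => X_sub_C_ne_zero _
  have hsplits : M.charpoly.Splits := by
    refine Splits.of_dvd (g := X ^ k * M.charpoly) ?_ hne (dvd_mul_left _ _)
    rw [← h]
    exact (Splits.X_pow l).mul (Splits.prod fun i _ => Splits.X_sub_C _)
  have hroots : M.charpoly.roots.prod = M.det :=
    (Matrix.det_eq_prod_roots_charpoly_of_splits hsplits).symm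
  have hzero : ∀ x ∈ M.charpoly.roots, x ≠ 0 := by
    rintro x hx rfl
    exact hM (hroots ▸ Multiset.prod_eq_zero hx)
  have hmu : (∏ i, (X - C (mu i))).roots = Finset.univ.val.map mu := by
    rw [roots_prod _ _ hprod]
    simp [Multiset.bind_singleton]
  have hr := congrArg (fun p => p.roots.filter (· ≠ 0)) h
  rw [roots_mul hne, roots_mul (h ▸ hne), hmu, Multiset.filter_add, Multiset.filter_add,
    Multiset.filter_eq_self.mpr hzero] at hr
  simp only [roots_X_pow, Multiset.filter_nsmul, Multiset.filter_singleton, ne_eq,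
    not_true_eq_false, if_false, Multiset.empty_eq_zero, smul_zero, zero_add,
    Multiset.filter_map] at hr
  rw [← hroots, ← hr]
  rfl

/-- For the even split, `B * Bᵀ` is diagonal with entries `m` at `s`, `1 / m` at `d` and `1`
elsewhere. -/
theorem splittingMatrix_even_mul_transpose (n : ℕ) (s d : Fin n) (hsd : s ≠ d) (m : ℕ)
    (hm : 1 ≤ m) :
    splittingMatrix n s d m (fun _ => 1 / (m : ℝ)) *
        (splittingMatrix n s d m (fun _ => 1 / (m : ℝ)))ᵀ =
      diagonal fun i => (if i = s then (m : ℝ) else 1) * (if i = d then (m : ℝ)⁻¹ else 1) := by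
  have hm0 : (m : ℝ) ≠ 0 := by positivity
  ext i j
  rw [mul_apply, diagonal_apply, Fintype.sum_sum_type, Fintype.sum_sum_type]
  simp only [splittingMatrix, transpose_apply, Finset.sum_const, Finset.card_univ,
    Fintype.card_fin, nsmul_eq_mul]
  have hsub : ∑ o : {o : Fin n // o ≠ s ∧ o ≠ d},
      (if i = o.val then (1 : ℝ) else 0) * (if j = o.val then 1 else 0) =
        if i = j ∧ i ≠ s ∧ i ≠ d then 1 else 0 := by
    rw [← Finset.sum_subtype (Finset.univ.filter fun o => o ≠ s ∧ o ≠ d) (by simp)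
      (fun o => (if i = o then (1 : ℝ) else 0) * (if j = o then 1 else 0))]
    simp only [ite_mul, one_mul, zero_mul, Finset.sum_ite_eq, Finset.mem_filter, Finset.mem_univ,
      true_and]
    grind
  rw [hsub]
  by_cases hij : i = j
  · subst hij
    by_cases his : i = s
    · subst his
      simp [hsd]
    · by_cases hid : i = d
      · subst hid
        simp [his, hm0]
      · simp [his, hid]
  · grind

theorem det_splittingMatrix_even_mul_transpose (n : ℕ) (s d : Fin n) (hsd : s ≠ d) (m : ℕ)
    (hm : 1 ≤ m) :
    (splittingMatrix n s d m (fun _ => 1 / (m : ℝ)) *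
      (splittingMatrix n s d m (fun _ => 1 / (m : ℝ)))ᵀ).det = 1 := by
  have hm0 : (m : ℝ) ≠ 0 := by positivity
  rw [splittingMatrix_even_mul_transpose n s d hsd m hm, det_diagonal, Finset.prod_mul_distrib]
  simp [hm0]

/-- The even (uniform) split `α i = 1/m` preserves the pseudo-determinant: for `H`
symmetric positive definite and `H' = Bᵀ H B` with `B` the even splitting matrix,
the product of the nonzero eigenvalues of `H'` (counted with multiplicity, encoded by
an eigenvalue list `mu` factoring the characteristic polynomial) equals `det H`. -/
theorem even_split_preserves_pdet
    (n : ℕ) (hn : 2 ≤ n) (s d : Fin n) (hsd : s ≠ d)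
    (m : ℕ) (hm : 1 ≤ m)
    (H : Matrix (Fin n) (Fin n) ℝ) (hH : H.PosDef)
    (mu : SplitIndex n s d m → ℝ)
    (hmuchar : ((splittingMatrix n s d m (fun _ => 1 / (m : ℝ)))ᵀ * H *
          splittingMatrix n s d m (fun _ => 1 / (m : ℝ))).charpoly
        = ∏ i, (X - C (mu i))) :
    ∏ i ∈ Finset.univ.filter (fun i => mu i ≠ 0), mu i = H.det := by
  set B := splittingMatrix n s d m (fun _ => 1 / (m : ℝ))
  have hdet : (H * (B * Bᵀ)).det = H.det := by
    rw [det_mul, det_splittingMatrix_even_mul_transpose n s d hsd m hm, mul_one]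
  rw [← hdet]
  have hcomm := charpoly_mul_comm' Bᵀ (H * B)
  rw [← Matrix.mul_assoc, hmuchar, Matrix.mul_assoc] at hcomm
  convert prod_ne_zero_eq_det_of_X_pow_mul_charpoly _ (hdet ▸ hH.det_pos.ne') mu _ _ hcomm
end

section
/- Let w, a, b ∈ ℝ. Then cos(w(t+a)) + cos(w(t+b)) = cos(w t) holds for all t ∈ ℝ if and only if there exist integers m and n such that either (w·a = π/3 + 2πm and w·b = −π/3 + 2πn) or (w·a = −π/3 + 2πm and w·b = π/3 + 2πn). -/
/-- If two unit vectors add up to `(1, 0)`, their angles are `π/3` and `-π/3` in some order,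
modulo `2π`. -/
theorem angles_of_cos_add_eq_one_of_sin_add_eq_zero {x y : ℝ}
    (hc : Real.cos x + Real.cos y = 1) (hs : Real.sin x + Real.sin y = 0) :
    ∃ m n : ℤ,
      (x = Real.pi / 3 + 2 * Real.pi * m ∧ y = -(Real.pi / 3) + 2 * Real.pi * n) ∨
      (x = -(Real.pi / 3) + 2 * Real.pi * m ∧ y = Real.pi / 3 + 2 * Real.pi * n) := by
  have hx : Real.cos (Real.pi / 3) = Real.cos x := by
    rw [Real.cos_pi_div_three]
    have hy := Real.sin_sq_add_cos_sq y
    rw [eq_sub_of_add_eq' hc, eq_neg_of_add_eq_zero_right hs] at hy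
    linarith [Real.sin_sq_add_cos_sq x]
  obtain ⟨m, hm⟩ := Real.cos_eq_cos_iff.mp hx
  have hxy : Real.cos (-x) = Real.cos y := by
    rw [Real.cos_neg]
    rw [Real.cos_pi_div_three] at hx
    linarith
  have hsxy : Real.sin (-x) = Real.sin y := by
    rw [Real.sin_neg]
    linarith
  have hangle : ((-x : ℝ) : Real.Angle) = (y : Real.Angle) :=
    Real.Angle.cos_sin_inj hxy hsxy
  obtain ⟨k, hk⟩ := Real.Angle.angle_eq_iff_two_pi_dvd_sub.mp hangle
  rcases hm with hm | hm
  · refine ⟨m, -m - k, Or.inl ⟨by linarith, ?_⟩⟩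
    push_cast
    linarith
  · refine ⟨m, -m - k, Or.inr ⟨by linarith, ?_⟩⟩
    push_cast
    linarith

/-- A frequency `w` and shifts `a`, `b` satisfy the cosine splitting identity iff the unit vectors
at angles `w * a` and `w * b` add up to `(1, 0)`. -/
theorem cos_splitting_iff_cos_add_eq_one_and_sin_add_eq_zero (w a b : ℝ) :
    (∀ t : ℝ, Real.cos (w * (t + a)) + Real.cos (w * (t + b)) = Real.cos (w * t)) ↔
      Real.cos (w * a) + Real.cos (w * b) = 1 ∧ Real.sin (w * a) + Real.sin (w * b) = 0 := by
  simp only [mul_add, Real.cos_add]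
  constructor
  · intro h
    have h0 : Real.cos (w * a) + Real.cos (w * b) = 1 := by simpa using h 0
    refine ⟨h0, ?_⟩
    rcases eq_or_ne w 0 with rfl | hw
    · simp
    have h1 := h (Real.pi / 2 / w)
    rw [mul_div_cancel₀ _ hw, Real.cos_pi_div_two, Real.sin_pi_div_two] at h1
    linarith
  · rintro ⟨hc, hs⟩ t
    linear_combination Real.cos (w * t) * hc - Real.sin (w * t) * hs

/-- `cos(w(t+a)) + cos(w(t+b)) = cos(wt)` holds for all `t ∈ ℝ` iff there are integers
`m, n` with `(wa, wb) = (π/3 + 2πm, −π/3 + 2πn)` or `(wa, wb) = (−π/3 + 2πm, π/3 + 2πn)`. -/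
theorem cosine_splitting_characterization (w a b : ℝ) :
    (∀ t : ℝ, Real.cos (w * (t + a)) + Real.cos (w * (t + b)) = Real.cos (w * t)) ↔
    ∃ m n : ℤ,
      (w * a = Real.pi / 3 + 2 * Real.pi * m ∧ w * b = -(Real.pi / 3) + 2 * Real.pi * n) ∨
      (w * a = -(Real.pi / 3) + 2 * Real.pi * m ∧ w * b = Real.pi / 3 + 2 * Real.pi * n) := by
  rw [cos_splitting_iff_cos_add_eq_one_and_sin_add_eq_zero]
  constructor
  · rintro ⟨hc, hs⟩
    exact angles_of_cos_add_eq_one_of_sin_add_eq_zero hc hs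
  · rintro ⟨m, n, ⟨ha, hb⟩ | ⟨ha, hb⟩⟩ <;>
    · rw [ha, hb, mul_comm (2 * Real.pi) (m : ℝ), mul_comm (2 * Real.pi) (n : ℝ)]
      simp only [Real.cos_add_int_mul_two_pi, Real.sin_add_int_mul_two_pi, Real.cos_neg,
        Real.sin_neg, Real.cos_pi_div_three]
      norm_num
end
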